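/- arXiv:2107.08083 — 3 statements merged into one kernel-verified Lean document; each statement's English description precedes it below -/
import Mathlib

section
/- Let a finite p-player normal-form game have payoff functions r^i and let r̂^i be another family of payoff functions (the empirical/meta-game payoffs) on the same strategy sets. Set ε = sup over all players i and all pure strategy profiles π of |r̂^i(π) − r^i(π)|. If the mixed strategy profile x is a Nash equilibrium of the game r̂ = (r̂^1, …, r̂^p), then x is a 2ε-Nash equilibrium of the game r = (r^1, …, r^p); that is, for every player i and every pure strategy a ∈ S^i, E_{π^{−i}∼x^{−i}}[r^i(a, π^{−i})] ≤ E_{π∼x}[r^i(π)] + 2ε. -/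
open Finset

/-- Expected payoff of player `i` under the mixed strategy profile `x`. -/
noncomputable def expectedPayoff {p : ℕ} {S : Fin p → Type} [∀ j, Fintype (S j)]
    (g : (∀ j, S j) → ℝ) (x : ∀ j, S j → ℝ) : ℝ :=
  ∑ π : ∀ j, S j, (∏ j, x j (π j)) * g π

/-- Expected payoff of player `i` when `i` deviates to the pure strategy `a`
while the other players follow the mixed profile `x` (the weights of player `i`
sum to one, so this equals the sum over the opponents' profiles). -/
noncomputable def deviationPayoff {p : ℕ} {S : Fin p → Type} [∀ j, Fintype (S j)]
    [∀ j, DecidableEq (S j)]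
    (g : (∀ j, S j) → ℝ) (x : ∀ j, S j → ℝ) (i : Fin p) (a : S i) : ℝ :=
  ∑ π : ∀ j, S j, (∏ j, x j (π j)) * g (Function.update π i a)

/-- Averaging against a product of probability weights preserves a uniform error bound. -/
theorem sum_prod_mul_le_add {p : ℕ} {S : Fin p → Type} [∀ j, Fintype (S j)]
    [∀ j, DecidableEq (S j)] {x : ∀ j, S j → ℝ} (hx_nonneg : ∀ j a, 0 ≤ x j a)
    (hx_sum : ∀ j, ∑ a, x j a = 1) {f g : (∀ j, S j) → ℝ} {ε : ℝ}
    (h : ∀ π, f π ≤ g π + ε) :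
    ∑ π : ∀ j, S j, (∏ j, x j (π j)) * f π ≤
      ∑ π : ∀ j, S j, (∏ j, x j (π j)) * g π + ε := by
  have hw : ∑ π : ∀ j, S j, ∏ j, x j (π j) = 1 := by
    rw [← Fintype.prod_sum]
    simp [hx_sum]
  calc
    ∑ π : ∀ j, S j, (∏ j, x j (π j)) * f π
        ≤ ∑ π : ∀ j, S j, (∏ j, x j (π j)) * (g π + ε) :=
      Finset.sum_le_sum fun π _ =>
        mul_le_mul_of_nonneg_left (h π) (Finset.prod_nonneg fun j _ => hx_nonneg j (π j))
    _ = ∑ π : ∀ j, S j, (∏ j, x j (π j)) * g π + ε := by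
      simp only [mul_add, Finset.sum_add_distrib, ← Finset.sum_mul, hw, one_mul]

/-- If `x` is a Nash equilibrium of the empirical game `rhat`,
then it is a `2ε`-Nash equilibrium of the game `r`, where
`ε = sup_{i, π} |rhat i π - r i π|`. -/
theorem nash_of_empirical_is_approx_nash
    {p : ℕ} (hp : 0 < p)
    (S : Fin p → Type) [∀ j, Fintype (S j)] [∀ j, Nonempty (S j)]
    [∀ j, DecidableEq (S j)]
    (r rhat : ∀ i : Fin p, (∀ j, S j) → ℝ)
    (x : ∀ j, S j → ℝ)
    (hx_nonneg : ∀ j a, 0 ≤ x j a)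
    (hx_sum : ∀ j, ∑ a, x j a = 1)
    (ε : ℝ)
    (hε : ε = ⨆ i : Fin p, ⨆ π : ∀ j, S j, |rhat i π - r i π|)
    (hNash : ∀ (i : Fin p) (a : S i),
      deviationPayoff (rhat i) x i a ≤ expectedPayoff (rhat i) x) :
    ∀ (i : Fin p) (a : S i),
      deviationPayoff (r i) x i a ≤ expectedPayoff (r i) x + 2 * ε := by
  intro i a
  have hbound : ∀ π, |rhat i π - r i π| ≤ ε := fun π => by
    rw [hε]
    exact (le_ciSup (f := fun π => |rhat i π - r i π|) (Set.finite_range _).bddAbove π).trans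
      (le_ciSup (f := fun i => ⨆ π : ∀ j, S j, |rhat i π - r i π|)
        (Set.finite_range _).bddAbove i)
  have hdev : deviationPayoff (r i) x i a ≤ deviationPayoff (rhat i) x i a + ε :=
    sum_prod_mul_le_add hx_nonneg hx_sum fun π => by
      linarith [(abs_le.mp (hbound (Function.update π i a))).1]
  have hexp : expectedPayoff (rhat i) x ≤ expectedPayoff (r i) x + ε :=
    sum_prod_mul_le_add hx_nonneg hx_sum fun π => by
      linarith [(abs_le.mp (hbound π)).2]
  linarith [hNash i a]
end

section
/- Consider a finite MDP with state set S, action set A, reward r, transition kernel T and discount γ ∈ [0,1). Let u : ℝ → ℝ satisfy the slope condition with constants 0 < ε₀ ≤ L, let x₀ ∈ ℝ, write ũ(x) = u(x) − x₀, and let 0 < α ≤ min(1/L, 1). Define the operator H on Q-functions by (Hq)(s,a) = α · ∑_{s'} T(s'|s,a) · ũ( r(s,a) + γ·max_{a'} q(s',a') − q(s,a) ) + q(s,a). Then H is a contraction in the sup-norm with modulus ᾱ = 1 − α(1−γ)ε₀ ∈ [0,1): for all Q-functions q, q', ‖Hq − Hq'‖_∞ ≤ (1 − α(1−γ)ε₀)·‖q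 − q'‖_∞. -/
open Finset

/-- Sup-norm on Q-functions over a finite state-action space. -/
noncomputable def supNormQ {S A : Type} [Fintype S] [Fintype A] [Nonempty S] [Nonempty A]
    (f : S → A → ℝ) : ℝ :=
  ⨆ p : S × A, |f p.1 p.2|

/-- `u` has slopes between `ε₀` and `L`. -/
def SlopeCondition (u : ℝ → ℝ) (ε₀ L : ℝ) : Prop :=
  ∀ x y : ℝ, x ≠ y → ε₀ ≤ (u x - u y) / (x - y) ∧ (u x - u y) / (x - y) ≤ L

/-- The risk-sensitive Q-learning operator
`(Hq)(s,a) = α · ∑_{s'} T(s'|s,a) · (u(r(s,a) + γ·max_{a'} q(s',a') − q(s,a)) − x₀) + q(s,a)`. -/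
noncomputable def riskOp {S A : Type} [Fintype S] [Fintype A] [Nonempty A]
    (r : S → A → ℝ) (T : S → A → S → ℝ) (γ : ℝ) (u : ℝ → ℝ) (x₀ α : ℝ)
    (q : S → A → ℝ) : S → A → ℝ :=
  fun s a =>
    α * ∑ s', T s a s' * (u (r s a + γ * (⨆ a', q s' a') - q s a) - x₀) + q s a

lemma abs_le_supNormQ {S A : Type} [Fintype S] [Fintype A] [Nonempty S] [Nonempty A]
    (f : S → A → ℝ) (s : S) (a : A) : |f s a| ≤ supNormQ f :=
  le_ciSup (f := fun p : S × A => |f p.1 p.2|) (Set.finite_range _).bddAbove (s, a)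

lemma abs_iSup_sub_iSup_le {A : Type} [Finite A] [Nonempty A] {f g : A → ℝ} {N : ℝ}
    (h : ∀ a, |f a - g a| ≤ N) : |(⨆ a, f a) - ⨆ a, g a| ≤ N := by
  rw [abs_sub_le_iff]
  constructor
  · rw [sub_le_iff_le_add]
    refine ciSup_le fun a => ?_
    have := le_ciSup (Set.finite_range g).bddAbove a
    linarith [(abs_sub_le_iff.1 (h a)).1]
  · rw [sub_le_iff_le_add]
    refine ciSup_le fun a => ?_
    have := le_ciSup (Set.finite_range f).bddAbove a
    linarith [(abs_sub_le_iff.1 (h a)).2]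

lemma SlopeCondition.exists_sub_eq_mul {u : ℝ → ℝ} {ε₀ L : ℝ} (hu : SlopeCondition u ε₀ L)
    (hε₀L : ε₀ ≤ L) (x y : ℝ) : ∃ c, ε₀ ≤ c ∧ c ≤ L ∧ u x - u y = c * (x - y) := by
  by_cases h : x = y
  · exact ⟨ε₀, le_rfl, hε₀L, by simp [h]⟩
  · exact ⟨_, (hu x y h).1, (hu x y h).2, (div_mul_cancel₀ _ (sub_ne_zero.2 h)).symm⟩

lemma abs_relaxed_step_le {α c ε₀ γ M d N : ℝ} (hα : 0 ≤ α) (hγ0 : 0 ≤ γ) (hγ1 : γ ≤ 1)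
    (hε₀ : 0 ≤ ε₀) (hc : ε₀ ≤ c) (hαc : α * c ≤ 1) (hM : |M| ≤ N) (hd : |d| ≤ N) :
    |α * (c * (γ * M - d)) + d| ≤ (1 - α * (1 - γ) * ε₀) * N := by
  have hN : 0 ≤ N := (abs_nonneg d).trans hd
  have hαc0 : 0 ≤ α * c * γ := mul_nonneg (mul_nonneg hα (hε₀.trans hc)) hγ0
  calc |α * (c * (γ * M - d)) + d| = |(1 - α * c) * d + α * c * γ * M| := by ring_nf
    _ ≤ |(1 - α * c) * d| + |α * c * γ * M| := abs_add_le _ _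
    _ = (1 - α * c) * |d| + α * c * γ * |M| := by
      rw [abs_mul, abs_mul, abs_of_nonneg (sub_nonneg.2 hαc), abs_of_nonneg hαc0]
    _ ≤ (1 - α * c) * N + α * c * γ * N := by
      have := sub_nonneg.2 hαc
      gcongr
    _ = (1 - α * (1 - γ) * c) * N := by ring
    _ ≤ (1 - α * (1 - γ) * ε₀) * N := by
      have := mul_nonneg hα (sub_nonneg.2 hγ1)
      gcongr

/-- The risk-sensitive operator `H` is a sup-norm contraction with
modulus `ᾱ = 1 − α(1−γ)ε₀ ∈ [0,1)`. -/
theorem riskOp_contraction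
    {S A : Type} [Fintype S] [Fintype A] [Nonempty S] [Nonempty A]
    (r : S → A → ℝ) (T : S → A → S → ℝ)
    (hT_nonneg : ∀ s a s', 0 ≤ T s a s')
    (hT_sum : ∀ s a, ∑ s', T s a s' = 1)
    (γ : ℝ) (hγ0 : 0 ≤ γ) (hγ1 : γ < 1)
    (u : ℝ → ℝ) (ε₀ L : ℝ) (hε₀ : 0 < ε₀) (hε₀L : ε₀ ≤ L)
    (hu : SlopeCondition u ε₀ L)
    (x₀ : ℝ) (α : ℝ) (hα0 : 0 < α) (hα1 : α ≤ min (1 / L) 1) :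
    0 ≤ 1 - α * (1 - γ) * ε₀ ∧ 1 - α * (1 - γ) * ε₀ < 1 ∧
    ∀ q q' : S → A → ℝ,
      supNormQ (fun s a => riskOp r T γ u x₀ α q s a - riskOp r T γ u x₀ α q' s a)
        ≤ (1 - α * (1 - γ) * ε₀) * supNormQ (fun s a => q s a - q' s a) := by
  have hL : 0 < L := hε₀.trans_le hε₀L
  have hαL : α * L ≤ 1 := (le_div_iff₀ hL).1 (hα1.trans (min_le_left _ _))
  have hαε : α * ε₀ ≤ 1 := (mul_le_mul_of_nonneg_left hε₀L hα0.le).trans hαL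
  have hpos : 0 < α * (1 - γ) * ε₀ := mul_pos (mul_pos hα0 (sub_pos.2 hγ1)) hε₀
  refine ⟨?_, by linarith, fun q q' => ciSup_le fun p => ?_⟩
  · nlinarith [mul_nonneg hγ0 (mul_pos hα0 hε₀).le]
  obtain ⟨s, a⟩ := p
  set N := supNormQ (fun s a => q s a - q' s a)
  have hN : ∀ s a, |q s a - q' s a| ≤ N := abs_le_supNormQ (fun s a => q s a - q' s a)
  set x : S → ℝ := fun s' => r s a + γ * (⨆ a', q s' a') - q s a with hx
  set y : S → ℝ := fun s' => r s a + γ * (⨆ a', q' s' a') - q' s a with hy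
  have hsum : riskOp r T γ u x₀ α q s a - riskOp r T γ u x₀ α q' s a
      = ∑ s', T s a s' * (α * (u (x s') - u (y s')) + (q s a - q' s a)) := by
    have hd : q s a - q' s a = ∑ s', T s a s' * (q s a - q' s a) := by
      rw [← sum_mul, hT_sum, one_mul]
    simp only [riskOp, mul_add (T s a _), sum_add_distrib, ← hd]
    rw [mul_sum, mul_sum, add_sub_add_comm, ← sum_sub_distrib]
    congr 1
    exact sum_congr rfl fun s' _ => by simp only [hx, hy]; ring
  have hterm : ∀ s', |α * (u (x s') - u (y s')) + (q s a - q' s a)|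
      ≤ (1 - α * (1 - γ) * ε₀) * N := fun s' => by
    obtain ⟨c, hc, hcL, h⟩ := hu.exists_sub_eq_mul hε₀L (x s') (y s')
    have hxy : x s' - y s' = γ * ((⨆ a', q s' a') - ⨆ a', q' s' a') - (q s a - q' s a) := by
      simp only [hx, hy]; ring
    rw [h, hxy]
    exact abs_relaxed_step_le hα0.le hγ0 hγ1.le hε₀.le hc
      ((mul_le_mul_of_nonneg_left hcL hα0.le).trans hαL) (abs_iSup_sub_iSup_le (hN s')) (hN s a)
  calc |riskOp r T γ u x₀ α q s a - riskOp r T γ u x₀ α q' s a|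
      ≤ ∑ s', |T s a s' * (α * (u (x s') - u (y s')) + (q s a - q' s a))| := by
        rw [hsum]; exact abs_sum_le_sum_abs _ _
    _ ≤ ∑ s', T s a s' * ((1 - α * (1 - γ) * ε₀) * N) := by
        refine sum_le_sum fun s' _ => ?_
        rw [abs_mul, abs_of_nonneg (hT_nonneg s a s')]
        exact mul_le_mul_of_nonneg_left (hterm s') (hT_nonneg s a s')
    _ = (1 - α * (1 - γ) * ε₀) * N := by rw [← sum_mul, hT_sum, one_mul]
end

section
/- Consider a finite MDP with state set S, action set A, reward r, transition kernel T and discount γ ∈ [0,1). Let u : ℝ → ℝ satisfy the slope condition with constants 0 < ε₀ ≤ L and let x₀ ∈ ℝ. Then there exists a unique Q-function Q* : S × A → ℝ solving the risk-sensitive Bellman equation ∑_{s'} T(s'|s,a) · u( r(s,a) + γ·max_{a'} Q*(s',a') − Q*(s,a) ) = x₀ for every state-action pair (s,a). -/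
open Finset

/-- The supremum over a finite type is nonexpansive for pointwise bounds. -/
lemma abs_ciSup_sub_ciSup_le_of_finite {ι : Type*} [Finite ι] [Nonempty ι] {f g : ι → ℝ} {M : ℝ}
    (h : ∀ i, |f i - g i| ≤ M) : |(⨆ i, f i) - ⨆ i, g i| ≤ M := by
  have hf : (⨆ i, f i) ≤ (⨆ i, g i) + M := ciSup_le fun i => by
    have := (abs_le.1 (h i)).2
    have := le_ciSup (Set.finite_range g).bddAbove i
    linarith
  have hg : (⨆ i, g i) ≤ (⨆ i, f i) + M := ciSup_le fun i => by
    have := (abs_le.1 (h i)).1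
    have := le_ciSup (Set.finite_range f).bddAbove i
    linarith
  exact abs_le.2 ⟨by linarith, by linarith⟩

lemma SlopeCondition.exists_slope {u : ℝ → ℝ} {ε₀ L : ℝ} (hu : SlopeCondition u ε₀ L)
    (h : ε₀ ≤ L) (x y : ℝ) : ∃ k, ε₀ ≤ k ∧ k ≤ L ∧ u x - u y = k * (x - y) := by
  rcases eq_or_ne x y with rfl | hxy
  · exact ⟨ε₀, le_rfl, h, by simp⟩
  · exact ⟨_, (hu x y hxy).1, (hu x y hxy).2, (div_mul_cancel₀ _ (sub_ne_zero.2 hxy)).symm⟩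

/-- A relaxed step along `u` with step size `L⁻¹` is a contraction. -/
lemma SlopeCondition.abs_relaxed_step_le {u : ℝ → ℝ} {ε₀ L : ℝ} (hu : SlopeCondition u ε₀ L)
    (hε₀ : 0 < ε₀) (h : ε₀ ≤ L) {γ : ℝ} (hγ0 : 0 ≤ γ) (hγ1 : γ < 1) {M c v w p q : ℝ}
    (hvw : |v - w| ≤ M) (hpq : |p - q| ≤ M) :
    |(p - q) + L⁻¹ * (u (c + γ * v - p) - u (c + γ * w - q))| ≤
      (1 - L⁻¹ * ε₀ * (1 - γ)) * M := by
  obtain ⟨k, hk, hkL, he⟩ := hu.exists_slope h (c + γ * v - p) (c + γ * w - q)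
  have hL : 0 < L := hε₀.trans_le h
  have hM : 0 ≤ M := (abs_nonneg _).trans hpq
  have ht0 : 0 ≤ L⁻¹ * k := by have := hε₀.trans_le hk; positivity
  have ht1 : L⁻¹ * k ≤ 1 := by
    rw [inv_mul_le_iff₀ hL]; linarith
  have hεt : L⁻¹ * ε₀ ≤ L⁻¹ * k := by gcongr
  calc
    _ = |(1 - L⁻¹ * k) * (p - q) + L⁻¹ * k * γ * (v - w)| := by rw [he]; congr 1; ring
    _ ≤ |(1 - L⁻¹ * k) * (p - q)| + |L⁻¹ * k * γ * (v - w)| := abs_add_le _ _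
    _ = (1 - L⁻¹ * k) * |p - q| + L⁻¹ * k * γ * |v - w| := by
      rw [abs_mul, abs_mul, abs_of_nonneg (sub_nonneg.2 ht1), abs_of_nonneg (mul_nonneg ht0 hγ0)]
    _ ≤ (1 - L⁻¹ * k) * M + L⁻¹ * k * γ * M := by
      have := sub_nonneg.2 ht1
      gcongr
    _ = (1 - L⁻¹ * k * (1 - γ)) * M := by ring
    _ ≤ _ := by
      have := sub_nonneg.2 hγ1.le
      gcongr

/-- Averaging with nonnegative weights of total mass one preserves a uniform bound. -/
lemma abs_sum_weights_mul_le {ι : Type*} [Fintype ι] {t f : ι → ℝ} {C : ℝ} (ht : ∀ i, 0 ≤ t i)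
    (ht1 : ∑ i, t i = 1) (hf : ∀ i, |f i| ≤ C) : |∑ i, t i * f i| ≤ C :=
  calc
    |∑ i, t i * f i| ≤ ∑ i, |t i * f i| := abs_sum_le_sum_abs _ _
    _ ≤ ∑ i, t i * C := sum_le_sum fun i _ => by
      rw [abs_mul, abs_of_nonneg (ht i)]
      exact mul_le_mul_of_nonneg_left (hf i) (ht i)
    _ = C := by rw [← sum_mul, ht1, one_mul]

/-- The risk-sensitive Bellman equation
`∑_{s'} T(s'|s,a) · u(r(s,a) + γ·max_{a'} Q*(s',a') − Q*(s,a)) = x₀` for all `(s,a)`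
has a unique solution `Q*`. -/
theorem riskSensitive_bellman_unique_solution
    {S A : Type} [Fintype S] [Fintype A] [Nonempty S] [Nonempty A]
    (r : S → A → ℝ) (T : S → A → S → ℝ)
    (hT_nonneg : ∀ s a s', 0 ≤ T s a s')
    (hT_sum : ∀ s a, ∑ s', T s a s' = 1)
    (γ : ℝ) (hγ0 : 0 ≤ γ) (hγ1 : γ < 1)
    (u : ℝ → ℝ) (ε₀ L : ℝ) (hε₀ : 0 < ε₀) (hε₀L : ε₀ ≤ L)
    (hu : SlopeCondition u ε₀ L)
    (x₀ : ℝ) :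
    ∃! Q : S → A → ℝ, ∀ s a,
      ∑ s', T s a s' * u (r s a + γ * (⨆ a', Q s' a') - Q s a) = x₀ := by
  have hL : 0 < L := hε₀.trans_le hε₀L
  have hLε : L⁻¹ * ε₀ ≤ 1 := by rw [inv_mul_le_iff₀ hL]; linarith
  have hLε0 : 0 < L⁻¹ * ε₀ := by positivity
  have hK0 : 0 ≤ 1 - L⁻¹ * ε₀ * (1 - γ) := by nlinarith
  have hK1 : 1 - L⁻¹ * ε₀ * (1 - γ) < 1 := by nlinarith
  let F : (S → A → ℝ) → S → A → ℝ := fun Q s a =>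
    Q s a + L⁻¹ * (∑ s', T s a s' * u (r s a + γ * (⨆ a', Q s' a') - Q s a) - x₀)
  have hF : ContractingWith ⟨1 - L⁻¹ * ε₀ * (1 - γ), hK0⟩ F := by
    refine ⟨hK1, LipschitzWith.of_dist_le_mul fun Q Q' => ?_⟩
    have hQ : ∀ s a, |Q s a - Q' s a| ≤ dist Q Q' := fun s a =>
      (dist_le_pi_dist (Q s) (Q' s) a).trans (dist_le_pi_dist Q Q' s)
    have hC : 0 ≤ (1 - L⁻¹ * ε₀ * (1 - γ)) * dist Q Q' := mul_nonneg hK0 dist_nonneg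
    refine (dist_pi_le_iff hC).2 fun s => (dist_pi_le_iff hC).2 fun a => ?_
    have key : F Q s a - F Q' s a = ∑ s', T s a s' * ((Q s a - Q' s a) + L⁻¹ *
        (u (r s a + γ * (⨆ a', Q s' a') - Q s a) -
          u (r s a + γ * (⨆ a', Q' s' a') - Q' s a))) := by
      simp only [F, mul_add, mul_left_comm (T s a _) L⁻¹, sum_add_distrib, ← mul_sum, ← sum_mul,
        hT_sum, mul_sub, sum_sub_distrib]
      ring
    rw [Real.dist_eq, key]
    exact abs_sum_weights_mul_le (hT_nonneg s a) (hT_sum s a) fun s' =>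
      hu.abs_relaxed_step_le hε₀ hε₀L hγ0 hγ1
        (abs_ciSup_sub_ciSup_le_of_finite (hQ s')) (hQ s a)
  have hfix : ∀ Q, (∀ s a, ∑ s', T s a s' * u (r s a + γ * (⨆ a', Q s' a') - Q s a) = x₀) ↔
      Function.IsFixedPt F Q := fun Q => by
    simp [Function.IsFixedPt, F, funext_iff, hL.ne', sub_eq_zero]
  simp only [hfix]
  exact ⟨_, hF.fixedPoint_isFixedPt, fun Q hQ => hF.fixedPoint_unique hQ⟩
end
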